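/- arXiv:1110.5027 — 2 statements merged into one kernel-verified Lean document; each statement's English description precedes it below -/
import Mathlib

section
/- Suppose 1 ≤ n ≤ N+K−1 (so that the quantum integers [1],…,[n] are all nonzero). Then there exists a nonzero idempotent g_n in the Hecke algebra H_n (the Jones–Wenzl antisymmetrizer) such that σ_i g_n = g_n σ_i = −q^{(1−N)/2N}·g_n for every i = 1,…,n−1, where −q^{(1−N)/2N} is the root of the quadratic relation q^{−1/2N}x − q^{1/2N}x^{−1} = q^{1/2} − q^{−1/2} with negative sign. -/
noncomputable section

/-- `qpow N K a = q^a = exp(2πi·a/(N+K))`, the fixed rational powers of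
`q = exp(2πi/(N+K))`. -/
def qpow (N K : ℕ) (a : ℚ) : ℂ :=
  Complex.exp (2 * (Real.pi : ℂ) * Complex.I * (a : ℂ) / ((N : ℂ) + (K : ℂ)))

/-- The group algebra over `ℂ` of the free group on generators indexed by `ι`:
the algebra with invertible generators `σ_i`, `i : ι`, and no further relations. -/
abbrev FreeAlg (ι : Type) := MonoidAlgebra ℂ (FreeGroup ι)

/-- The generator `σ_i` in the free algebra. -/
def genF {ι : Type} (i : ι) : FreeAlg ι := MonoidAlgebra.of ℂ (FreeGroup ι) (FreeGroup.of i)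

/-- The inverse generator `σ_i⁻¹` in the free algebra. -/
def genFinv {ι : Type} (i : ι) : FreeAlg ι :=
  MonoidAlgebra.of ℂ (FreeGroup ι) (FreeGroup.of i)⁻¹

/-- The defining relations of the Hecke algebra `H(N,K)` with generators `σ_i`, `i : ι`,
where `d : ι → ℕ` records the position of each generator (so `σ_i`, `σ_j` are adjacent when
`d i + 1 = d j`): the braid relations, distant commutation, and the quadratic relation
`q^{−1/2N}σ_i − q^{1/2N}σ_i^{−1} = (q^{1/2} − q^{−1/2})·1`. -/
inductive heckeRel (N K : ℕ) {ι : Type} (d : ι → ℕ) : FreeAlg ι → FreeAlg ι → Prop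
  | braid (i j : ι) (h : d i + 1 = d j) :
      heckeRel N K d (genF i * genF j * genF i) (genF j * genF i * genF j)
  | comm (i j : ι) (h : d i + 2 ≤ d j) :
      heckeRel N K d (genF i * genF j) (genF j * genF i)
  | quad (i : ι) :
      heckeRel N K d
        (qpow N K (-(1 / (2 * (N : ℚ)))) • genF i - qpow N K (1 / (2 * (N : ℚ))) • genFinv i)
        ((qpow N K (1 / 2) - qpow N K (-(1 / 2))) • (1 : FreeAlg ι))

/-- The Hecke algebra: the quotient of the group algebra of the free group by the
two-sided ideal (ring congruence) generated by the Hecke relations. -/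
abbrev Hecke (N K : ℕ) {ι : Type} (d : ι → ℕ) := RingQuot (heckeRel N K d)

/-- The generator `σ_i` of the Hecke algebra. -/
def σH (N K : ℕ) {ι : Type} (d : ι → ℕ) (i : ι) : Hecke N K d :=
  RingQuot.mkAlgHom ℂ (heckeRel N K d) (genF i)

/-- The Hecke algebra `H_n(N,K)` on generators `σ_1,…,σ_{n−1}`
(indexed by `Fin (n−1)`, with index `i` corresponding to `σ_{i+1}`). -/
abbrev HeckeFin (N K m : ℕ) := Hecke N K (fun i : Fin m => (i : ℕ))

/-- The generator `σ_{i+1}` of `H_n(N,K)`, `i : Fin (n−1)`. -/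
def σFin (N K m : ℕ) (i : Fin m) : HeckeFin N K m :=
  σH N K (fun j : Fin m => (j : ℕ)) i


/-! ### Abstract antisymmetrizer -/

/-- Hecke relations for the elements `s 0, …, s (M-1)` of an algebra, with quadratic relation
`s² = z s + p`. -/
structure HeckeSys {A : Type*} [Ring A] [Algebra ℂ A] (M : ℕ) (z p : ℂ) (s : ℕ → A) : Prop where
  quad : ∀ i, i < M → s i * s i = z • s i + p • (1 : A)
  braid : ∀ i, i + 1 < M → s i * s (i + 1) * s i = s (i + 1) * s i * s (i + 1)
  comm : ∀ i j, i + 2 ≤ j → j < M → s i * s j = s j * s i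

/-- Weighted sum of the minimal coset representatives. -/
def cosetSum {A : Type*} [Ring A] [Algebra ℂ A] (a : ℂ) (s : ℕ → A) : ℕ → A
  | 0 => 1
  | m + 1 => 1 + a • (cosetSum a s m * s m)

/-- The unnormalized antisymmetrizer. -/
def antiSym {A : Type*} [Ring A] [Algebra ℂ A] (a : ℂ) (s : ℕ → A) : ℕ → A
  | 0 => 1
  | m + 1 => cosetSum a s (m + 1) * antiSym a s m

/-- The geometric sum `1 + r + … + r ^ m`. -/
def geo (r : ℂ) : ℕ → ℂ
  | 0 => 1
  | m + 1 => 1 + r * geo r m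

/-- The product of the geometric sums. -/
def geoFact (r : ℂ) : ℕ → ℂ
  | 0 => 1
  | m + 1 => geo r (m + 1) * geoFact r m

section
variable {A : Type*} [Ring A] [Algebra ℂ A] {M : ℕ} {z p a c : ℂ} {s : ℕ → A}

theorem cosetSum_comm (h : HeckeSys M z p s) (j m : ℕ) (hjm : j < m) (hm : m < M) :
    s m * cosetSum a s j = cosetSum a s j * s m := by
  induction j with
  | zero => simp [cosetSum]
  | succ j ih =>
    have h1 := ih (by omega)
    have h2 := h.comm j m (by omega) hm
    simp only [cosetSum, mul_add, add_mul, mul_one, one_mul, mul_smul_comm, smul_mul_assoc]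
    rw [← mul_assoc, h1, mul_assoc, ← h2, mul_assoc]

theorem cosetSum_absorb (h : HeckeSys M z p s) (h1 : a * p = c) (h2 : a * z + 1 = c * a)
    (m : ℕ) (hm : m < M) : ∀ x : A, (∀ i, i < m → s i * x = c • x) →
      ∀ i, i < m + 1 → s i * (cosetSum a s (m + 1) * x) = c • (cosetSum a s (m + 1) * x) := by
  induction m with
  | zero =>
    intro x _ i hi
    obtain rfl : i = 0 := by omega
    have hq := h.quad 0 hm
    simp only [cosetSum, one_mul, add_mul, mul_add, smul_mul_assoc, mul_smul_comm]
    rw [← mul_assoc, hq, ← h1]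
    simp only [add_mul, smul_mul_assoc, one_mul, smul_add, smul_smul]
    have : a * p * a = a * z + 1 := by rw [h2, ← h1]
    rw [this]
    module
  | succ m ih =>
    intro x hx i hi
    have e : cosetSum a s (m + 2) * x = x + a • (cosetSum a s (m + 1) * (s (m + 1) * x)) := by
      simp only [cosetSum, add_mul, one_mul, smul_mul_assoc, mul_assoc]
    by_cases him : i < m + 1
    · have := ih (by omega) (s (m + 1) * x) (fun j hj => by
        rw [← mul_assoc, h.comm j (m + 1) (by omega) hm, mul_assoc, hx j (by omega),
          mul_smul_comm]) i him
      rw [e, mul_add, mul_smul_comm, this, hx i him, smul_add, smul_comm]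
    · obtain rfl : i = m + 1 := by omega
      have e2 : cosetSum a s (m + 1) * (s (m + 1) * x)
          = s (m + 1) * x + a • (cosetSum a s m * (s m * (s (m + 1) * x))) := by
        simp only [cosetSum, add_mul, one_mul, smul_mul_assoc, mul_assoc]
      have hb : s (m + 1) * (s m * (s (m + 1) * x)) = c • (s m * (s (m + 1) * x)) := by
        rw [← mul_assoc, ← mul_assoc, ← h.braid m hm, mul_assoc, hx m (by omega), mul_smul_comm,
          mul_assoc]
      have hc : s (m + 1) * (cosetSum a s m * (s m * (s (m + 1) * x)))
          = c • (cosetSum a s m * (s m * (s (m + 1) * x))) := by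
        rw [← mul_assoc, cosetSum_comm h m (m + 1) (by omega) hm, mul_assoc, hb, mul_smul_comm]
      have hq : s (m + 1) * (s (m + 1) * x) = z • (s (m + 1) * x) + p • x := by
        rw [← mul_assoc, h.quad _ hm, add_mul, smul_mul_assoc, smul_mul_assoc, one_mul]
      rw [e, e2]
      generalize cosetSum a s m * (s m * (s (m + 1) * x)) = w at *
      simp only [mul_add, mul_smul_comm, hc, hq, smul_add, smul_smul]
      have h3 : a * z = c * a - 1 := by rw [← h2]; ring
      rw [h1, h3]
      module

theorem antiSym_left (h : HeckeSys M z p s) (h1 : a * p = c) (h2 : a * z + 1 = c * a)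
    (m : ℕ) (hm : m ≤ M) : ∀ i, i < m → s i * antiSym a s m = c • antiSym a s m := by
  induction m with
  | zero => intro i hi; omega
  | succ m ih => exact cosetSum_absorb h h1 h2 m (by omega) _ (ih (by omega))

theorem cosetSum_right (y : A) (m : ℕ) (hy : ∀ i, i < m → y * s i = c • y) :
    y * cosetSum a s m = geo (a * c) m • y := by
  induction m with
  | zero => simp [cosetSum, geo]
  | succ m ih =>
    simp only [cosetSum, geo, mul_add, mul_one, mul_smul_comm]
    rw [← mul_assoc, ih (fun i hi => hy i (by omega)), smul_mul_assoc, hy m (by omega)]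
    module

theorem antiSym_right (y : A) (m : ℕ) (hy : ∀ i, i < m → y * s i = c • y) :
    y * antiSym a s m = geoFact (a * c) m • y := by
  induction m with
  | zero => simp [antiSym, geoFact]
  | succ m ih =>
    simp only [antiSym, geoFact]
    rw [← mul_assoc, cosetSum_right y (m + 1) hy, smul_mul_assoc,
      ih (fun i hi => hy i (by omega)), smul_smul]

theorem map_cosetSum {B : Type*} [Ring B] [Algebra ℂ B] (f : A →ₐ[ℂ] B) (m : ℕ) :
    f (cosetSum a s m) = cosetSum a (fun i => f (s i)) m := by
  induction m with
  | zero => simp [cosetSum]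
  | succ m ih => simp [cosetSum, ih]

theorem map_antiSym {B : Type*} [Ring B] [Algebra ℂ B] (f : A →ₐ[ℂ] B) (m : ℕ) :
    f (antiSym a s m) = antiSym a (fun i => f (s i)) m := by
  induction m with
  | zero => simp [antiSym]
  | succ m ih => simp [antiSym, ih, map_cosetSum]

theorem HeckeSys.op (h : HeckeSys M z p s) :
    HeckeSys M z p (fun i => MulOpposite.op (s i)) where
  quad i hi := by
    rw [← MulOpposite.op_mul, h.quad i hi]; simp
  braid i hi := by
    simp only [← MulOpposite.op_mul]
    rw [← mul_assoc, ← mul_assoc, h.braid i hi]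
  comm i j hij hj := by
    simp only [← MulOpposite.op_mul]
    rw [h.comm i j hij hj]

theorem exists_antisymmetrizer (h : HeckeSys M z p s) (h1 : a * p = c) (h2 : a * z + 1 = c * a)
    (hr : geoFact (a * c) M ≠ 0) (χ : A →ₐ[ℂ] ℂ) (hχ : ∀ i, i < M → χ (s i) = c) :
    ∃ g : A, g ≠ 0 ∧ g * g = g ∧ ∀ i, i < M → s i * g = c • g ∧ g * s i = c • g := by
  set L := antiSym a s M with hL
  have hl : ∀ i, i < M → s i * L = c • L := antiSym_left h h1 h2 M le_rfl
  set R' := antiSym a (fun i => MulOpposite.op (s i)) M with hR'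
  have hr' : ∀ i, i < M → R'.unop * s i = c • R'.unop := fun i hi => by
    have := antiSym_left h.op h1 h2 M le_rfl i hi
    simpa using congrArg MulOpposite.unop this
  have e1 : R'.unop * L = geoFact (a * c) M • R'.unop := antiSym_right _ M hr'
  have e2 : R'.unop * L = geoFact (a * c) M • L := by
    have := antiSym_right (a := a) (c := c) (s := fun i => MulOpposite.op (s i))
      (MulOpposite.op L) M (fun i hi => by
        rw [← MulOpposite.op_mul, hl i hi]; simp)
    simpa using congrArg MulOpposite.unop this
  have e3 : R'.unop = L := by
    have := e1.symm.trans e2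
    exact smul_right_injective A hr this
  rw [e3] at hr' e1
  have hχL : χ L = geoFact (a * c) M := by
    have := antiSym_right (a := a) (c := c) (s := fun i => χ (s i)) (1 : ℂ) M
      (fun i hi => by simp [hχ i hi])
    rw [hL, map_antiSym]
    simpa using this
  refine ⟨(geoFact (a * c) M)⁻¹ • L, ?_, ?_, ?_⟩
  · intro h0
    have := congrArg χ h0
    rw [map_smul, hχL, map_zero, smul_eq_mul, inv_mul_cancel₀ hr] at this
    exact one_ne_zero this
  · rw [smul_mul_assoc, mul_smul_comm, e1, inv_smul_smul₀ hr]
  · intro i hi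
    rw [mul_smul_comm, hl i hi, smul_mul_assoc, hr' i hi, smul_comm]
    exact ⟨rfl, rfl⟩

end

theorem geo_mul (r : ℂ) (m : ℕ) : (r - 1) * geo r m = r ^ (m + 1) - 1 := by
  induction m with
  | zero => simp [geo]
  | succ m ih =>
    simp only [geo]
    calc _ = (r - 1) + r * ((r - 1) * geo r m) := by ring
      _ = _ := by rw [ih]; ring

theorem geoFact_ne_zero (r : ℂ) (m : ℕ) (h : ∀ k, 1 ≤ k → k ≤ m + 1 → r ^ k ≠ 1) :
    geoFact r m ≠ 0 := by
  induction m with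
  | zero => simp [geoFact]
  | succ m ih =>
    refine mul_ne_zero ?_ (ih fun k hk hk' => h k hk (by omega))
    intro h0
    have := geo_mul r (m + 1)
    rw [h0, mul_zero] at this
    exact h (m + 2) (by omega) le_rfl (sub_eq_zero.mp this.symm)

theorem qpow_add (N K : ℕ) (x y : ℚ) : qpow N K (x + y) = qpow N K x * qpow N K y := by
  unfold qpow
  rw [← Complex.exp_add]
  congr 1
  push_cast
  ring

theorem qpow_zero (N K : ℕ) : qpow N K 0 = 1 := by simp [qpow]

theorem qpow_neg_one_pow_ne (N K : ℕ) (hNK : 0 < N + K) (k : ℕ) (hk : 1 ≤ k) (hk' : k < N + K) :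
    qpow N K (-1) ^ k ≠ 1 := by
  have hp := Complex.isPrimitiveRoot_exp (N + K) (by omega)
  have e : qpow N K (-1) = (Complex.exp (2 * Real.pi * Complex.I / ((N + K : ℕ) : ℂ)))⁻¹ := by
    rw [← Complex.exp_neg]
    unfold qpow
    congr 1
    push_cast
    ring
  rw [e]
  exact hp.inv.pow_ne_one_of_pos_of_lt (by omega) hk'

theorem genF_mul_genFinv {ι : Type} (i : ι) : (genF i : FreeAlg ι) * genFinv i = 1 := by
  unfold genF genFinv
  rw [← map_mul, mul_inv_cancel, map_one]

/-- The generators of `H_n` extended by zero to all natural indices. -/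
def sExt (N K M : ℕ) (i : ℕ) : HeckeFin N K M := if h : i < M then σFin N K M ⟨i, h⟩ else 0

theorem sExt_heckeSys (N K M : ℕ) :
    HeckeSys M ((qpow N K (1 / 2) - qpow N K (-(1 / 2))) * qpow N K (1 / (2 * (N : ℚ))))
      (qpow N K (1 / (2 * (N : ℚ))) ^ 2) (sExt N K M) where
  quad i hi := by
    have hαβ : qpow N K (1 / (2 * (N : ℚ))) * qpow N K (-(1 / (2 * (N : ℚ)))) = 1 := by
      rw [← qpow_add, add_neg_cancel, qpow_zero]
    have hr := RingQuot.mkAlgHom_rel ℂ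
      (heckeRel.quad (N := N) (K := K) (d := fun i : Fin M => (i : ℕ)) ⟨i, hi⟩)
    have hinv := congrArg (RingQuot.mkAlgHom ℂ (heckeRel N K (fun i : Fin M => (i : ℕ))))
      (genF_mul_genFinv (⟨i, hi⟩ : Fin M))
    simp only [map_mul, map_sub, map_smul, map_one] at hr hinv
    simp only [sExt, hi, dite_true, σFin, σH]
    generalize RingQuot.mkAlgHom ℂ (heckeRel N K (fun i : Fin M => (i : ℕ)))
      (genF ⟨i, hi⟩) = t at *
    generalize RingQuot.mkAlgHom ℂ (heckeRel N K (fun i : Fin M => (i : ℕ)))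
      (genFinv ⟨i, hi⟩) = t' at *
    generalize qpow N K (1 / (2 * (N : ℚ))) = β at *
    generalize qpow N K (-(1 / (2 * (N : ℚ)))) = α at *
    generalize qpow N K (1 / 2) - qpow N K (-(1 / 2)) = w at *
    have h3 := congrArg (fun y => β • (t * y)) hr
    simp only [mul_sub, mul_smul_comm, hinv, smul_sub, smul_smul, hαβ, one_smul, mul_one] at h3
    rw [sub_eq_iff_eq_add] at h3
    rw [h3, mul_comm w β, pow_two]
  braid i hi := by
    have hr := RingQuot.mkAlgHom_rel ℂ
      (heckeRel.braid (N := N) (K := K) (d := fun i : Fin M => (i : ℕ))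
        ⟨i, by omega⟩ ⟨i + 1, hi⟩ rfl)
    have hi' : i < M := by omega
    simp only [map_mul] at hr
    simpa only [sExt, hi, hi', dite_true, σFin, σH] using hr
  comm i j hij hj := by
    have hr := RingQuot.mkAlgHom_rel ℂ
      (heckeRel.comm (N := N) (K := K) (d := fun i : Fin M => (i : ℕ))
        ⟨i, by omega⟩ ⟨j, hj⟩ hij)
    have hi' : i < M := by omega
    simp only [map_mul] at hr
    simpa only [sExt, hj, hi', dite_true, σFin, σH] using hr

theorem exists_character (N K M : ℕ) (c : ℂ) (hc : c ≠ 0)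
    (hq : qpow N K (-(1 / (2 * (N : ℚ)))) * c - qpow N K (1 / (2 * (N : ℚ))) * c⁻¹
      = qpow N K (1 / 2) - qpow N K (-(1 / 2))) :
    ∃ χ : HeckeFin N K M →ₐ[ℂ] ℂ, ∀ i, χ (σFin N K M i) = c := by
  let f : FreeAlg (Fin M) →ₐ[ℂ] ℂ := MonoidAlgebra.lift ℂ ℂ (FreeGroup (Fin M))
    ((Units.coeHom ℂ).comp (FreeGroup.lift fun _ => Units.mk0 c hc))
  have hf : ∀ i, f (genF i) = c := fun i => by simp [f, genF]
  have hf' : ∀ i, f (genFinv i) = c⁻¹ := fun i => by simp [f, genFinv]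
  refine ⟨RingQuot.liftAlgHom ℂ ⟨f, ?_⟩, ?_⟩
  · intro x y hxy
    cases hxy with
    | braid i j h => simp [hf]
    | comm i j h => simp [hf]
    | quad i =>
      simp only [map_sub, map_smul, map_one, hf, hf', smul_eq_mul, mul_one]
      exact hq
  · intro i
    simp only [σFin, σH]
    rw [RingQuot.liftAlgHom_mkAlgHom_apply]
    exact hf i

/-- Suppose `1 ≤ n ≤ N+K−1` (so that the quantum integers `[1],…,[n]` are all
nonzero).  Then there exists a nonzero idempotent `g_n` in the Hecke algebra `H_n`
(the Jones–Wenzl antisymmetrizer) such that `σ_i g_n = g_n σ_i = −q^{(1−N)/2N}·g_n` for every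
`i = 1,…,n−1`. -/
theorem statement7 (N K n : ℕ) (hN : 2 ≤ N) (hK : 1 ≤ K)
    (hn1 : 1 ≤ n) (hn2 : n ≤ N + K - 1) :
    ∃ g : HeckeFin N K (n - 1),
      g ≠ 0 ∧ g * g = g ∧
        ∀ i : Fin (n - 1),
          σFin N K (n - 1) i * g = (-(qpow N K ((1 - (N : ℚ)) / (2 * N)))) • g ∧
            g * σFin N K (n - 1) i = (-(qpow N K ((1 - (N : ℚ)) / (2 * N)))) • g := by
  have hN0 : (N : ℚ) ≠ 0 := by
    have : N ≠ 0 := by omega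
    exact_mod_cast this
  have hαβ : qpow N K (1 / (2 * (N : ℚ))) * qpow N K (-(1 / (2 * (N : ℚ)))) = 1 := by
    rw [← qpow_add, add_neg_cancel, qpow_zero]
  have hvv : qpow N K (1 / 2) * qpow N K (-(1 / 2)) = 1 := by
    rw [← qpow_add, add_neg_cancel, qpow_zero]
  have hc : qpow N K ((1 - (N : ℚ)) / (2 * N))
      = qpow N K (1 / (2 * (N : ℚ))) * qpow N K (-(1 / 2)) := by
    rw [← qpow_add]
    congr 1
    field_simp
    ring
  have hsq : qpow N K (-(1 / 2)) * qpow N K (-(1 / 2)) = qpow N K (-1) := by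
    rw [← qpow_add]
    norm_num
  have hsys := sExt_heckeSys N K (n - 1)
  have hchar := exists_character N K (n - 1)
  rw [hc]
  generalize qpow N K (1 / (2 * (N : ℚ))) = β at *
  generalize qpow N K (-(1 / (2 * (N : ℚ)))) = α at *
  generalize qpow N K (1 / 2) = v at *
  generalize qpow N K (-(1 / 2)) = v' at *
  have hβ0 : β ≠ 0 := left_ne_zero_of_mul_eq_one hαβ
  have hv0 : v ≠ 0 := left_ne_zero_of_mul_eq_one hvv
  have hα : α = β⁻¹ := eq_inv_of_mul_eq_one_right hαβ
  have hv' : v' = v⁻¹ := eq_inv_of_mul_eq_one_right hvv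
  obtain ⟨χ, hχ⟩ := hchar (-(β * v')) (by rw [hv']; simp [hβ0, hv0]) (by
    rw [hα, hv']
    field_simp
    ring)
  obtain ⟨g, hg0, hgg, hg⟩ := exists_antisymmetrizer (a := -(α * v')) (c := -(β * v')) hsys
    (by rw [hα, hv']; field_simp) (by rw [hα, hv']; field_simp; ring)
    (by
      have e : -(α * v') * -(β * v') = qpow N K (-1) := by
        rw [← hsq]
        linear_combination (v' * v') * hαβ
      rw [e]
      exact geoFact_ne_zero _ _ fun k hk hk' =>
        qpow_neg_one_pow_ne N K (by omega) k hk (by omega))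
    χ (fun i hi => by simp only [sExt, hi, dite_true]; exact hχ _)
  refine ⟨g, hg0, hgg, fun i => ?_⟩
  have := hg i i.2
  simpa only [sExt, i.2, dite_true] using this
end
end

section
/- A Markov trace on H_∞ is uniquely determined by its parameter: if Tr and Tr' are two Markov traces on H_∞ with the same parameter η ∈ ℂ, then Tr = Tr'. -/
noncomputable section

/-- The infinite Hecke algebra `H_∞(N,K)` with generators `σ_i` for `i ≥ 1`
(indexed by `ℕ`, with index `i` corresponding to `σ_{i+1}`). -/
abbrev HeckeInf (N K : ℕ) := Hecke N K (fun i : ℕ => i)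

/-- The generator `σ_{i+1}` of `H_∞(N,K)`, for `i : ℕ`. -/
def σInf (N K : ℕ) (i : ℕ) : HeckeInf N K := σH N K (fun j : ℕ => j) i

/-- The subalgebra `H_n ⊆ H_∞`, generated by `σ_1,…,σ_{n−1}` (indices `i` with `i+1 < n`);
in particular `H_1 = ℂ·1`. -/
def Hn (N K n : ℕ) : Subalgebra ℂ (HeckeInf N K) :=
  Algebra.adjoin ℂ {x : HeckeInf N K | ∃ i : ℕ, i + 1 < n ∧ x = σInf N K i}

/-- The spectral idempotent `e_n = (q+1)^{−1}(q·1 − q^{(N−1)/2N}σ_n)` in `H_∞`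
(for `n ≥ 1`, the generator `σ_n` has index `n−1`, so `e_n = eInf N K (n−1)`). -/
def eInf (N K : ℕ) (i : ℕ) : HeckeInf N K :=
  (qpow N K 1 + 1)⁻¹ •
    (qpow N K 1 • (1 : HeckeInf N K) - qpow N K (((N : ℚ) - 1) / (2 * N)) • σInf N K i)

/-! ### Generic part -/

def PP {A : Type} [Ring A] [Algebra ℂ A] (s : ℕ → A) (n : ℕ) : Subalgebra ℂ A :=
  Algebra.adjoin ℂ {x : A | ∃ i : ℕ, i < n ∧ x = s i}

def MM {A : Type} [Ring A] [Algebra ℂ A] (s : ℕ → A) (n : ℕ) : Submodule ℂ A :=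
  Subalgebra.toSubmodule (PP s n) ⊔
    Submodule.span ℂ {z : A | ∃ x ∈ PP s n, ∃ y ∈ PP s n, z = x * s n * y}

section generic

variable {A : Type} [Ring A] [Algebra ℂ A] {s : ℕ → A}

theorem PP_mono {m n : ℕ} (h : m ≤ n) : PP s m ≤ PP s n := by
  apply Algebra.adjoin_mono
  rintro x ⟨i, hi, rfl⟩
  exact ⟨i, by omega, rfl⟩

theorem s_mem_PP {i n : ℕ} (h : i < n) : s i ∈ PP s n :=
  Algebra.subset_adjoin ⟨i, h, rfl⟩

theorem PP_le_MM {n : ℕ} {x : A} (h : x ∈ PP s n) : x ∈ MM s n :=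
  Submodule.mem_sup_left h

theorem xsy_mem_MM {n : ℕ} {x y : A} (hx : x ∈ PP s n) (hy : y ∈ PP s n) :
    x * s n * y ∈ MM s n :=
  Submodule.mem_sup_right (Submodule.subset_span ⟨x, hx, y, hy, rfl⟩)

theorem MM_ind {n : ℕ} (Q : Submodule ℂ A) (h1 : ∀ x ∈ PP s n, x ∈ Q)
    (h2 : ∀ x ∈ PP s n, ∀ y ∈ PP s n, x * s n * y ∈ Q) : MM s n ≤ Q := by
  refine sup_le h1 (Submodule.span_le.2 ?_)
  rintro z ⟨x, hx, y, hy, rfl⟩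
  exact h2 x hx y hy

theorem MM_left {n : ℕ} {w z : A} (hw : w ∈ PP s n) (hz : z ∈ MM s n) : w * z ∈ MM s n := by
  have := MM_ind (s := s) (n := n) ((MM s n).comap (LinearMap.mulLeft ℂ w)) (fun x hx => by
    simpa using PP_le_MM (mul_mem hw hx)) (fun x hx y hy => by
    simpa [mul_assoc] using xsy_mem_MM (mul_mem hw hx) hy)
  simpa using this hz

theorem MM_right {n : ℕ} {w z : A} (hw : w ∈ PP s n) (hz : z ∈ MM s n) : z * w ∈ MM s n := by
  have := MM_ind (s := s) (n := n) ((MM s n).comap (LinearMap.mulRight ℂ w)) (fun x hx => by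
    simpa using PP_le_MM (mul_mem hx hw)) (fun x hx y hy => by
    simpa [mul_assoc] using xsy_mem_MM hx (mul_mem hy hw))
  simpa using this hz

theorem PP_comm (hc : ∀ i j, i + 2 ≤ j → s i * s j = s j * s i) {n : ℕ} {x : A}
    (hx : x ∈ PP s n) : s (n + 1) * x = x * s (n + 1) := by
  have : PP s n ≤ Subalgebra.centralizer ℂ {s (n + 1)} := by
    apply Algebra.adjoin_le
    rintro x ⟨i, hi, rfl⟩
    simp only [Subalgebra.coe_centralizer, Set.mem_centralizer_iff, Set.mem_singleton_iff,
      forall_eq]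
    exact (hc i (n + 1) (by omega)).symm
  have h := this hx
  rw [Subalgebra.mem_centralizer_iff] at h
  exact h _ rfl

theorem PP_succ_le {n : ℕ} (hC : ∀ z ∈ PP s n, s n * z * s n ∈ MM s n) {x : A}
    (hx : x ∈ PP s (n + 1)) : x ∈ MM s n := by
  have hs : ∀ z ∈ MM s n, s n * z ∈ MM s n := by
    intro z hz
    have := MM_ind (s := s) (n := n) ((MM s n).comap (LinearMap.mulLeft ℂ (s n)))
      (fun x hx => by simpa using xsy_mem_MM (one_mem _) hx) (fun x hx y hy => by
        simpa [mul_assoc] using MM_right hy (hC x hx))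
    simpa using this hz
  have key : ∀ z ∈ MM s n, x * z ∈ MM s n := by
    refine Algebra.adjoin_induction (p := fun x _ => ∀ z ∈ MM s n, x * z ∈ MM s n)
      ?_ ?_ ?_ ?_ hx
    · rintro x ⟨i, hi, rfl⟩ z hz
      rcases Nat.lt_succ_iff_lt_or_eq.1 hi with h | rfl
      · exact MM_left (s_mem_PP h) hz
      · exact hs z hz
    · intro r z hz
      rw [← Algebra.smul_def]
      exact Submodule.smul_mem _ _ hz
    · intro x y _ _ h1 h2 z hz
      rw [add_mul]
      exact add_mem (h1 z hz) (h2 z hz)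
    · intro x y _ _ h1 h2 z hz
      rw [mul_assoc]
      exact h1 _ (h2 z hz)
  simpa using key 1 (PP_le_MM (one_mem _))

theorem sq_mem {a b : ℂ} (hq : ∀ i, s i * s i = a • s i + b • 1) (n : ℕ) :
    s n * s n ∈ MM s n := by
  rw [hq]
  refine add_mem (Submodule.smul_mem _ _ ?_) (Submodule.smul_mem _ _ (PP_le_MM (one_mem _)))
  simpa using xsy_mem_MM (s := s) (n := n) (one_mem _) (one_mem _)

theorem szs_mem {a b : ℂ} (hq : ∀ i, s i * s i = a • s i + b • 1)
    (hb : ∀ i, s i * s (i + 1) * s i = s (i + 1) * s i * s (i + 1))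
    (hc : ∀ i j, i + 2 ≤ j → s i * s j = s j * s i) (n : ℕ) :
    ∀ z ∈ PP s n, s n * z * s n ∈ MM s n := by
  induction n with
  | zero =>
    intro z hz
    have : PP s 0 = ⊥ := by simp [PP]
    rw [this, Algebra.mem_bot] at hz
    obtain ⟨r, rfl⟩ := hz
    rw [← Algebra.commutes, mul_assoc, ← Algebra.smul_def]
    exact Submodule.smul_mem _ _ (sq_mem hq 0)
  | succ n ih =>
    intro z hz
    have hz := PP_succ_le ih hz
    have := MM_ind (s := s) (n := n) ((MM s (n + 1)).comap
      (LinearMap.mulRight ℂ (s (n + 1)) ∘ₗ LinearMap.mulLeft ℂ (s (n + 1))))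
      (fun x hx => by
        simp only [Submodule.mem_comap, LinearMap.comp_apply, LinearMap.mulLeft_apply,
          LinearMap.mulRight_apply]
        rw [PP_comm hc hx, mul_assoc]
        exact MM_left (PP_mono (by omega) hx) (sq_mem hq _))
      (fun x hx y hy => by
        simp only [Submodule.mem_comap, LinearMap.comp_apply, LinearMap.mulLeft_apply,
          LinearMap.mulRight_apply]
        have e : s (n + 1) * (x * s n * y) * s (n + 1) =
            (x * s n) * s (n + 1) * (s n * y) := by
          calc s (n + 1) * (x * s n * y) * s (n + 1)
              = (s (n + 1) * x) * s n * (y * s (n + 1)) := by simp only [mul_assoc]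
            _ = (x * s (n + 1)) * s n * (s (n + 1) * y) := by
                rw [PP_comm hc hx, PP_comm hc hy]
            _ = x * (s (n + 1) * s n * s (n + 1)) * y := by simp only [mul_assoc]
            _ = _ := by rw [← hb]; simp only [mul_assoc]
        rw [e]
        exact xsy_mem_MM (mul_mem (PP_mono (by omega) hx) (s_mem_PP (by omega)))
          (mul_mem (s_mem_PP (by omega)) (PP_mono (by omega) hy)))
    simpa using this hz

theorem trace_eq {a b : ℂ} (hq : ∀ i, s i * s i = a • s i + b • 1)
    (hb : ∀ i, s i * s (i + 1) * s i = s (i + 1) * s i * s (i + 1))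
    (hc : ∀ i j, i + 2 ≤ j → s i * s j = s j * s i)
    (T T' : A →ₗ[ℂ] ℂ) (hT : ∀ x y, T (x * y) = T (y * x)) (hT' : ∀ x y, T' (x * y) = T' (y * x))
    (h1 : T 1 = T' 1) (c : ℂ)
    (hM : ∀ n, ∀ x ∈ PP s n, T (x * s n) = c * T x)
    (hM' : ∀ n, ∀ x ∈ PP s n, T' (x * s n) = c * T' x) (n : ℕ) :
    ∀ x ∈ PP s n, T x = T' x := by
  induction n with
  | zero =>
    intro z hz
    have : PP s 0 = ⊥ := by simp [PP]
    rw [this, Algebra.mem_bot] at hz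
    obtain ⟨r, rfl⟩ := hz
    simp [Algebra.algebraMap_eq_smul_one, h1]
  | succ n ih =>
    intro z hz
    have hz := PP_succ_le (szs_mem hq hb hc n) hz
    have := MM_ind (s := s) (n := n) (LinearMap.eqLocus T T') ih (fun x hx y hy => by
      rw [LinearMap.mem_eqLocus, hT, hT', ← mul_assoc, hM n _ (mul_mem hy hx),
        hM' n _ (mul_mem hy hx), ih _ (mul_mem hy hx)])
    exact this hz

end generic

theorem qpow_ne (N K : ℕ) (a : ℚ) : qpow N K a ≠ 0 := Complex.exp_ne_zero _

theorem q_add_one_ne (N K : ℕ) (hN : 2 ≤ N) (hK : 1 ≤ K) : qpow N K 1 + 1 ≠ 0 := by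
  intro h
  have h2 : qpow N K 1 = -1 := by linear_combination h
  have hpos : (0 : ℝ) < (N : ℝ) + K := by positivity
  have h3 : (3 : ℝ) ≤ (N : ℝ) + K := by exact_mod_cast (by omega : 3 ≤ N + K)
  have e : qpow N K 1 = Complex.exp (((2 * Real.pi / ((N : ℝ) + K) : ℝ) : ℂ) * Complex.I) := by
    unfold qpow
    congr 1
    push_cast
    ring
  have hs := congrArg Complex.im h2
  rw [e, Complex.exp_ofReal_mul_I_im] at hs
  have : 0 < Real.sin (2 * Real.pi / ((N : ℝ) + K)) := by
    apply Real.sin_pos_of_pos_of_lt_pi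
    · have := Real.pi_pos
      positivity
    · rw [div_lt_iff₀ hpos]
      nlinarith [Real.pi_pos]
  simp at hs
  linarith

theorem genF_mul_inv {ι : Type} (i : ι) : genF i * genFinv i = 1 := by
  unfold genF genFinv
  rw [← map_mul, mul_inv_cancel, map_one]

def σinv (N K : ℕ) (i : ℕ) : HeckeInf N K :=
  RingQuot.mkAlgHom ℂ (heckeRel N K (fun j : ℕ => j)) (genFinv i)

theorem σ_mul_inv (N K i : ℕ) : σInf N K i * σinv N K i = 1 := by
  unfold σInf σH σinv
  rw [← map_mul, genF_mul_inv, map_one]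

theorem σ_quad (N K i : ℕ) :
    qpow N K (-(1 / (2 * (N : ℚ)))) • σInf N K i - qpow N K (1 / (2 * (N : ℚ))) • σinv N K i
      = (qpow N K (1 / 2) - qpow N K (-(1 / 2))) • (1 : HeckeInf N K) := by
  have := RingQuot.mkAlgHom_rel ℂ (heckeRel.quad (N := N) (K := K) (d := fun j : ℕ => j) i)
  simp only [map_sub, map_smul, map_one] at this
  exact this

theorem exists_PP (N K : ℕ) (z : HeckeInf N K) : ∃ n, z ∈ PP (σInf N K) n := by
  obtain ⟨w, rfl⟩ := RingQuot.mkAlgHom_surjective ℂ (heckeRel N K (fun j : ℕ => j)) z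
  have hinv : ∀ i, σinv N K i ∈ PP (σInf N K) (i + 1) := by
    intro i
    have h0 := qpow_ne N K (1 / (2 * (N : ℚ)))
    have h := σ_quad N K i
    rw [sub_eq_iff_eq_add, ← sub_eq_iff_eq_add'] at h
    rw [← inv_smul_smul₀ h0 (σinv N K i), ← h]
    exact Subalgebra.smul_mem _ (sub_mem (Subalgebra.smul_mem _ (s_mem_PP (by omega)) _)
      (Subalgebra.smul_mem _ (one_mem _) _)) _
  have hmul : ∀ x y : HeckeInf N K, (∃ n, x ∈ PP (σInf N K) n) → (∃ n, y ∈ PP (σInf N K) n) →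
      ∃ n, x * y ∈ PP (σInf N K) n := by
    rintro x y ⟨m, hm⟩ ⟨n, hn⟩
    exact ⟨max m n, mul_mem (PP_mono (le_max_left _ _) hm) (PP_mono (le_max_right _ _) hn)⟩
  induction w using MonoidAlgebra.induction_on with
  | of g =>
    induction g using FreeGroup.induction_on with
    | C1 => exact ⟨0, by rw [map_one, map_one]; exact one_mem _⟩
    | of i => exact ⟨i + 1, s_mem_PP (s := σInf N K) (by omega)⟩
    | inv_of i _ => exact ⟨i + 1, hinv i⟩
    | mul x y hx hy =>
      rw [map_mul, map_mul]
      exact hmul _ _ hx hy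
  | add x y hx hy =>
    obtain ⟨m, hm⟩ := hx
    obtain ⟨n, hn⟩ := hy
    rw [map_add]
    exact ⟨max m n, add_mem (PP_mono (le_max_left _ _) hm) (PP_mono (le_max_right _ _) hn)⟩
  | smul r x hx =>
    obtain ⟨m, hm⟩ := hx
    rw [map_smul]
    exact ⟨m, Subalgebra.smul_mem _ hm _⟩

theorem markov_σ (N K : ℕ) (hN : 2 ≤ N) (hK : 1 ≤ K) (η : ℂ) (T : HeckeInf N K →ₗ[ℂ] ℂ)
    (hM : ∀ n : ℕ, 1 ≤ n → ∀ x ∈ Hn N K n, T (x * eInf N K (n - 1)) = η * T x) (n : ℕ) :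
    ∀ x ∈ PP (σInf N K) n, T (x * σInf N K n) =
      ((qpow N K 1 - η * (qpow N K 1 + 1)) / qpow N K (((N : ℚ) - 1) / (2 * N))) * T x := by
  intro x hx
  have hx' : x ∈ Hn N K (n + 1) := by
    simpa [Hn, PP] using hx
  have h := hM (n + 1) (by omega) x hx'
  have h1 := q_add_one_ne N K hN hK
  have h2 := qpow_ne N K (((N : ℚ) - 1) / (2 * N))
  simp only [eInf, Nat.add_sub_cancel, mul_smul_comm, mul_sub, mul_one, map_smul, map_sub,
    smul_eq_mul] at h
  generalize qpow N K (((N : ℚ) - 1) / (2 * N)) = β at *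
  generalize qpow N K 1 = q at *
  generalize T (x * σInf N K n) = t at *
  field_simp at h ⊢
  linear_combination -h

/-- A Markov trace on `H_∞` is uniquely determined by its parameter: if `Tr`
and `Tr'` are two `ℂ`-linear functionals with `Tr(xy) = Tr(yx)`, `Tr(1) = 1`, and the Markov
property `Tr(x·e_n) = η·Tr(x)` for all `n ≥ 1` and `x ∈ H_n`, with the same parameter
`η ∈ ℂ`, then `Tr = Tr'`. -/
theorem statement11 (N K : ℕ) (hN : 2 ≤ N) (hK : 1 ≤ K) (η : ℂ)
    (Tr Tr' : HeckeInf N K →ₗ[ℂ] ℂ)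
    (hTr : ∀ x y : HeckeInf N K, Tr (x * y) = Tr (y * x)) (hTr1 : Tr 1 = 1)
    (hTrM : ∀ n : ℕ, 1 ≤ n → ∀ x ∈ Hn N K n, Tr (x * eInf N K (n - 1)) = η * Tr x)
    (hTr' : ∀ x y : HeckeInf N K, Tr' (x * y) = Tr' (y * x)) (hTr'1 : Tr' 1 = 1)
    (hTr'M : ∀ n : ℕ, 1 ≤ n → ∀ x ∈ Hn N K n, Tr' (x * eInf N K (n - 1)) = η * Tr' x) :
    Tr = Tr' := by
  have h0 := qpow_ne N K (-(1 / (2 * (N : ℚ))))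
  have hq : ∀ i, σInf N K i * σInf N K i =
      ((qpow N K (-(1 / (2 * (N : ℚ)))))⁻¹ * (qpow N K (1 / 2) - qpow N K (-(1 / 2)))) • σInf N K i
      + ((qpow N K (-(1 / (2 * (N : ℚ)))))⁻¹ * qpow N K (1 / (2 * (N : ℚ)))) • 1 := by
    intro i
    have h := congrArg (fun z => σInf N K i * z) (σ_quad N K i)
    simp only [mul_sub, mul_smul_comm, σ_mul_inv, mul_one] at h
    rw [sub_eq_iff_eq_add] at h
    rw [← inv_smul_smul₀ h0 (σInf N K i * σInf N K i), h, smul_add, smul_smul, smul_smul]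
  have hb : ∀ i, σInf N K i * σInf N K (i + 1) * σInf N K i =
      σInf N K (i + 1) * σInf N K i * σInf N K (i + 1) := by
    intro i
    have := RingQuot.mkAlgHom_rel ℂ
      (heckeRel.braid (N := N) (K := K) (d := fun j : ℕ => j) i (i + 1) rfl)
    simp only [map_mul] at this
    exact this
  have hc : ∀ i j, i + 2 ≤ j → σInf N K i * σInf N K j = σInf N K j * σInf N K i := by
    intro i j hij
    have := RingQuot.mkAlgHom_rel ℂ
      (heckeRel.comm (N := N) (K := K) (d := fun j : ℕ => j) i j hij)
    simp only [map_mul] at this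
    exact this
  ext z
  obtain ⟨n, hn⟩ := exists_PP N K z
  exact trace_eq hq hb hc Tr Tr' hTr hTr' (hTr1.trans hTr'1.symm) _
    (markov_σ N K hN hK η Tr hTrM) (markov_σ N K hN hK η Tr' hTr'M) n z hn
end
end
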